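/- arXiv:2103.12942 — 4 statements merged into one kernel-verified Lean document; each statement's English description precedes it below -/
import Mathlib

section
/- There exist constants ᾱ₀ ≥ 1 and q̄₀ ≥ 1 such that for every ᾱ ≥ ᾱ₀, every q̄ ≥ q̄₀, and every smooth mean-zero 2π-periodic function v : ℝ → ℝ, one has the two-sided bound (1/2)·( ‖Dv‖_{L²}² + ᾱ (‖v‖_{L²}² + 1)^{q̄} ) ≤ ∫₀^{2π} ( (Dv(x))² − v(x)³/3 ) dx + ᾱ (‖v‖_{L²}² + 1)^{q̄} ≤ (3/2)·( ‖Dv‖_{L²}² + ᾱ (‖v‖_{L²}² + 1)^{q̄} ). -/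
open MeasureTheory Real Filter

noncomputable section

/-- A smooth, mean-zero, `2π`-periodic function `v : ℝ → ℝ`. -/
def SmoothMeanZeroPeriodic (v : ℝ → ℝ) : Prop :=
  ContDiff ℝ (⊤ : ℕ∞) v ∧ (∀ x : ℝ, v (x + 2 * Real.pi) = v x) ∧
    (∫ x in (0:ℝ)..(2 * Real.pi), v x) = 0

/-- The `L²` norm over one period: `(∫₀^{2π} |v|²)^{1/2}`. -/
def L2norm (v : ℝ → ℝ) : ℝ := Real.sqrt (∫ x in (0:ℝ)..(2 * Real.pi), (v x) ^ 2)

theorem exists_eq_zero_of_intervalIntegral_eq_zero {f : ℝ → ℝ} (hf : Continuous f) {a b : ℝ}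
    (hab : a < b) (h : ∫ x in a..b, f x = 0) : ∃ c ∈ Set.Ioo a b, f c = 0 := by
  have hd : ∀ x, HasDerivAt (fun y => ∫ t in a..y, f t) (f x) x := fun x =>
    intervalIntegral.integral_hasDerivAt_right (hf.intervalIntegrable _ _)
      hf.aestronglyMeasurable.stronglyMeasurableAtFilter hf.continuousAt
  exact exists_hasDerivAt_eq_zero hab
    (fun x _ => (hd x).continuousAt.continuousWithinAt) (by simp [h]) (fun x _ => hd x)

/-- A `C¹` function with zero integral on an interval is bounded there by its total variation. -/
theorem abs_le_integral_abs_deriv_of_integral_eq_zero {f : ℝ → ℝ} (hf : ContDiff ℝ 1 f)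
    {a b : ℝ} (hab : a < b) (h : ∫ x in a..b, f x = 0) {x : ℝ} (hx : x ∈ Set.Icc a b) :
    |f x| ≤ (∫ t in a..b, |deriv f t|) := by
  obtain ⟨c, hc, hfc⟩ := exists_eq_zero_of_intervalIntegral_eq_zero hf.continuous hab h
  have hd : Continuous (deriv f) := hf.continuous_deriv le_rfl
  have key : ∫ t in c..x, deriv f t = f x := by
    rw [intervalIntegral.integral_deriv_eq_sub
      (fun t _ => (hf.differentiable one_ne_zero).differentiableAt)
      (hd.intervalIntegrable _ _), hfc, sub_zero]
  have hsub : Set.uIoc c x ⊆ Set.uIoc a b := by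
    rw [Set.uIoc_of_le hab.le]
    exact Set.Ioc_subset_Ioc (le_min hc.1.le hx.1) (max_le hc.2.le hx.2)
  rw [← key]
  calc |∫ t in c..x, deriv f t| ≤ |(∫ t in c..x, |deriv f t|)| := by
        simpa only [Real.norm_eq_abs] using
          intervalIntegral.norm_integral_le_abs_integral_norm (f := deriv f) (a := c) (b := x)
    _ ≤ |(∫ t in a..b, |deriv f t|)| :=
        intervalIntegral.abs_integral_mono_interval hsub
          (Eventually.of_forall fun t => abs_nonneg _) (hd.abs.intervalIntegrable _ _)
    _ = (∫ t in a..b, |deriv f t|) :=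
        abs_of_nonneg (intervalIntegral.integral_nonneg hab.le fun t _ => abs_nonneg _)

/-- Cauchy–Schwarz against the constant function `1`. -/
theorem sq_integral_abs_le {g : ℝ → ℝ} (hg : Continuous g) {a b : ℝ} (hab : a < b) :
    (∫ t in a..b, |g t|) ^ 2 ≤ (b - a) * ∫ t in a..b, g t ^ 2 := by
  set M := ∫ t in a..b, |g t| with hM
  have hL : 0 < b - a := sub_pos.2 hab
  have h0 : 0 ≤ ∫ t in a..b, ((b - a) * |g t| - M) ^ 2 :=
    intervalIntegral.integral_nonneg hab.le fun t _ => sq_nonneg _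
  have h1 : ∫ t in a..b, ((b - a) * |g t| - M) ^ 2
      = (b - a) ^ 2 * (∫ t in a..b, g t ^ 2) - 2 * (b - a) * M * M + (b - a) * M ^ 2 := by
    have e : ∀ t, ((b - a) * |g t| - M) ^ 2
        = (b - a) ^ 2 * g t ^ 2 - 2 * (b - a) * M * |g t| + M ^ 2 := fun t => by
      rw [← sq_abs (g t)]; ring
    simp_rw [e]
    rw [intervalIntegral.integral_add, intervalIntegral.integral_sub,
      intervalIntegral.integral_const_mul, intervalIntegral.integral_const_mul,
      intervalIntegral.integral_const, ← hM, smul_eq_mul]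
    all_goals exact Continuous.intervalIntegrable (by fun_prop) _ _
  refine le_of_mul_le_mul_left ?_ hL
  nlinarith

theorem abs_integral_cube_le {f : ℝ → ℝ} (hf : Continuous f) {a b M : ℝ} (hab : a ≤ b)
    (hM : ∀ x ∈ Set.Icc a b, |f x| ≤ M) :
    |∫ x in a..b, f x ^ 3| ≤ M * ∫ x in a..b, f x ^ 2 := by
  rw [← intervalIntegral.integral_const_mul]
  refine (intervalIntegral.abs_integral_le_integral_abs hab).trans ?_
  refine intervalIntegral.integral_mono_on hab
    (Continuous.intervalIntegrable (by fun_prop) _ _)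
    (Continuous.intervalIntegrable (by fun_prop) _ _) fun x hx => ?_
  rw [abs_pow, pow_succ', sq_abs]
  exact mul_le_mul_of_nonneg_right (hM x hx) (sq_nonneg _)

theorem L2norm_sq (v : ℝ → ℝ) : L2norm v ^ 2 = ∫ x in (0:ℝ)..(2 * Real.pi), v x ^ 2 :=
  Real.sq_sqrt (intervalIntegral.integral_nonneg Real.two_pi_pos.le fun _ _ => sq_nonneg _)

/-- equivalence of the positivized modified Hamiltonian `𝓘₁⁺`
with `‖Dv‖² + ᾱ(‖v‖² + 1)^q̄`. -/
theorem modified_hamiltonian_equivalence :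
    ∃ α₀ : ℝ, 1 ≤ α₀ ∧ ∃ q₀ : ℝ, 1 ≤ q₀ ∧
      ∀ α : ℝ, α₀ ≤ α → ∀ q : ℝ, q₀ ≤ q →
        ∀ v : ℝ → ℝ, SmoothMeanZeroPeriodic v →
          (1 / 2) * ((L2norm (deriv v)) ^ 2 + α * ((L2norm v) ^ 2 + 1) ^ q)
            ≤ (∫ x in (0:ℝ)..(2 * Real.pi), ((deriv v x) ^ 2 - (v x) ^ 3 / 3))
                + α * ((L2norm v) ^ 2 + 1) ^ q ∧
          (∫ x in (0:ℝ)..(2 * Real.pi), ((deriv v x) ^ 2 - (v x) ^ 3 / 3))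
                + α * ((L2norm v) ^ 2 + 1) ^ q
            ≤ (3 / 2) * ((L2norm (deriv v)) ^ 2 + α * ((L2norm v) ^ 2 + 1) ^ q) := by
  refine ⟨1, le_rfl, 2, one_le_two, fun α hα q hq v ⟨hv, _, hmean⟩ => ?_⟩
  have hv1 : ContDiff ℝ 1 v := hv.of_le (by exact_mod_cast le_top)
  have hd : Continuous (deriv v) := hv1.continuous_deriv le_rfl
  have hc : Continuous v := hv1.continuous
  have hcube := abs_integral_cube_le hc Real.two_pi_pos.le fun x hx =>
    abs_le_integral_abs_deriv_of_integral_eq_zero hv1 Real.two_pi_pos hmean hx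
  have hcs := sq_integral_abs_le hd Real.two_pi_pos
  have hsplit : ∫ x in (0:ℝ)..(2 * Real.pi), ((deriv v x) ^ 2 - (v x) ^ 3 / 3)
      = L2norm (deriv v) ^ 2 - (∫ x in (0:ℝ)..(2 * Real.pi), (v x) ^ 3) / 3 := by
    rw [L2norm_sq, intervalIntegral.integral_sub, intervalIntegral.integral_div]
    all_goals exact Continuous.intervalIntegrable (by fun_prop) _ _
  rw [← L2norm_sq] at hcs hcube
  rw [hsplit]
  have hB : 0 ≤ L2norm v ^ 2 := sq_nonneg _
  have hA : 0 ≤ L2norm (deriv v) ^ 2 := sq_nonneg _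
  generalize L2norm v ^ 2 = B at *
  generalize L2norm (deriv v) ^ 2 = A at *
  generalize (∫ x in (0:ℝ)..(2 * Real.pi), |deriv v x|) = M at *
  generalize (∫ x in (0:ℝ)..(2 * Real.pi), (v x) ^ 3) = T at *
  have hpow : (B + 1) ^ 2 ≤ α * (B + 1) ^ q := by
    have h2 : (B + 1) ^ 2 ≤ (B + 1) ^ q := by
      rw [← Real.rpow_two]
      exact Real.rpow_le_rpow_of_exponent_le (by linarith) hq
    nlinarith [sq_nonneg (B + 1)]
  have hM : M ^ 2 ≤ 8 * A := by nlinarith [Real.pi_le_four]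
  have hMB : M * B ≤ 3 / 2 * A + 3 / 2 * (B + 1) ^ 2 := by
    nlinarith [sq_nonneg (3 * M - 8 * B)]
  obtain ⟨h1, h2⟩ := abs_le.1 hcube
  constructor <;> linarith
end
end

section
/- There exists a universal constant ᾱ₀ ≥ 1 such that for every ᾱ ≥ ᾱ₀ and every smooth mean-zero 2π-periodic function v : ℝ → ℝ, one has (1/2)·( ‖D²v‖_{L²}² + ᾱ (‖v‖_{L²}² + 1)^{7/3} ) ≤ ∫₀^{2π} ( (D²v(x))² − (5/3) v(x) (Dv(x))² + (5/36) v(x)⁴ ) dx + ᾱ (‖v‖_{L²}² + 1)^{7/3} ≤ (3/2)·( ‖D²v‖_{L²}² + ᾱ (‖v‖_{L²}² + 1)^{7/3} ). -/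
open MeasureTheory Real Filter

noncomputable section

/-- Cauchy–Schwarz inequality for continuous functions on a compact interval. -/
theorem sq_intervalIntegral_mul_le {f g : ℝ → ℝ} (hf : Continuous f) (hg : Continuous g)
    {a b : ℝ} (hab : a ≤ b) :
    (∫ x in a..b, f x * g x) ^ 2 ≤ (∫ x in a..b, f x ^ 2) * ∫ x in a..b, g x ^ 2 := by
  have h : ∀ t : ℝ, 0 ≤ (∫ x in a..b, f x ^ 2) * (t * t) + (2 * ∫ x in a..b, f x * g x) * t
      + ∫ x in a..b, g x ^ 2 := by
    intro t
    have h0 : 0 ≤ ∫ x in a..b, (t * f x + g x) ^ 2 :=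
      intervalIntegral.integral_nonneg hab fun x _ => sq_nonneg _
    have h1 : ∫ x in a..b, (t * f x + g x) ^ 2
        = ∫ x in a..b, ((t * t) * f x ^ 2 + (2 * t) * (f x * g x) + g x ^ 2) := by
      congr 1; ext x; ring
    rw [h1, intervalIntegral.integral_add
        (Continuous.intervalIntegrable (by fun_prop) _ _)
        (Continuous.intervalIntegrable (by fun_prop) _ _),
      intervalIntegral.integral_add
        (Continuous.intervalIntegrable (by fun_prop) _ _)
        (Continuous.intervalIntegrable (by fun_prop) _ _),
      intervalIntegral.integral_const_mul, intervalIntegral.integral_const_mul] at h0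
    linarith
  have hd := discrim_le_zero h
  unfold discrim at hd
  linarith

/-- Agmon-type pointwise bound for a `C¹` function of vanishing mean. -/
theorem sq_le_two_mul_integral_abs_mul_abs_deriv {v : ℝ → ℝ} (hv : ContDiff ℝ 1 v)
    {a b : ℝ} (hab : a < b) (h : ∫ x in a..b, v x = 0) {x : ℝ} (hx : x ∈ Set.Icc a b) :
    v x ^ 2 ≤ 2 * ∫ t in a..b, |v t| * |deriv v t| := by
  have hc := hv.continuous
  have hc' : Continuous (deriv v) := hv.continuous_deriv le_rfl
  obtain ⟨c, hcm, hc0⟩ := exists_eq_zero_of_intervalIntegral_eq_zero hc hab h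
  have hftc : ∫ t in c..x, 2 * (v t * deriv v t) = v x ^ 2 - v c ^ 2 := by
    refine intervalIntegral.integral_eq_sub_of_hasDerivAt (f := fun t => v t ^ 2)
      (fun t _ => ?_) (Continuous.intervalIntegrable (by fun_prop) _ _)
    have := ((hv.differentiable one_ne_zero t).hasDerivAt).pow 2
    simp only [Nat.cast_ofNat, Nat.add_one_sub_one, pow_one, mul_assoc] at this
    exact this
  rw [hc0, intervalIntegral.integral_const_mul, zero_pow two_ne_zero] at hftc
  have habs : |∫ t in c..x, v t * deriv v t| ≤ ∫ t in a..b, |v t| * |deriv v t| := by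
    calc |∫ t in c..x, v t * deriv v t|
        ≤ |(∫ t in c..x, |v t * deriv v t|)| :=
          intervalIntegral.norm_integral_le_abs_integral_norm (f := fun t => v t * deriv v t)
      _ ≤ |(∫ t in a..b, |v t * deriv v t|)| := by
          refine intervalIntegral.abs_integral_mono_interval ?_
            (Eventually.of_forall fun t => abs_nonneg _)
            (Continuous.intervalIntegrable (by fun_prop) _ _)
          rw [Set.uIoc_of_le hab.le]
          intro t ht
          rw [Set.mem_uIoc] at ht
          rcases ht with ht | ht
          · exact ⟨hcm.1.trans ht.1, ht.2.trans hx.2⟩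
          · exact ⟨hx.1.trans_lt ht.1, ht.2.trans hcm.2.le⟩
      _ = ∫ t in a..b, |v t| * |deriv v t| := by
          simp only [abs_mul]
          exact abs_of_nonneg (intervalIntegral.integral_nonneg hab.le fun t _ => by positivity)
  have := le_abs_self (∫ t in c..x, v t * deriv v t)
  linarith

/-- Interpolation of the first derivative between a function and its second derivative in `L²`,
for periodic boundary values. -/
theorem sq_integral_deriv_sq_le {v : ℝ → ℝ} (hv : ContDiff ℝ 2 v) {a b : ℝ} (hab : a ≤ b)
    (h0 : v b = v a) (h1 : deriv v b = deriv v a) :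
    (∫ x in a..b, deriv v x ^ 2) ^ 2
      ≤ (∫ x in a..b, v x ^ 2) * ∫ x in a..b, deriv (deriv v) x ^ 2 := by
  have hd : ContDiff ℝ 1 (deriv v) := ContDiff.deriv' (by simpa [one_add_one_eq_two] using hv)
  have hc'' : Continuous (deriv (deriv v)) := hd.continuous_deriv le_rfl
  have hp := intervalIntegral.integral_mul_deriv_eq_deriv_mul (a := a) (b := b)
    (fun x _ => (hv.differentiable two_ne_zero x).hasDerivAt)
    (fun x _ => (hd.differentiable one_ne_zero x).hasDerivAt)
    (hd.continuous.intervalIntegrable _ _) (hc''.intervalIntegrable _ _)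
  rw [h0, h1, sub_self, zero_sub] at hp
  have hsq : ∫ x in a..b, deriv v x ^ 2 = ∫ x in a..b, deriv v x * deriv v x := by
    simp only [sq]
  have := sq_intervalIntegral_mul_le hv.continuous hc'' hab
  rw [hp, neg_sq, ← hsq] at this
  exact this

/-- Young-type inequality absorbing the cubic term. -/
theorem mul_le_of_pow_four_le {m b c : ℝ} (hb : 0 ≤ b) (hmb : m ^ 4 ≤ 4 * b)
    (hbc : b ^ 2 ≤ c) : 5 / 3 * (m * b) ≤ c / 4 + 100000 := by
  have hm : m ≤ b / 10 + 40 := by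
    by_contra! h
    have h40 : 40 ≤ m := by linarith
    have : 40 ^ 3 * m ≤ m ^ 3 * m := by gcongr
    nlinarith
  have : m * b ≤ (b / 10 + 40) * b := by gcongr
  nlinarith [sq_nonneg (b - 800)]

/-- Young-type inequality absorbing the quartic term. -/
theorem sq_le_of_pow_four_le {m b c : ℝ} (hmb : m ^ 4 ≤ 4 * b) (hbc : b ^ 2 ≤ c) :
    5 / 36 * m ^ 2 ≤ c / 4 + 100000 := by
  nlinarith [sq_nonneg (m ^ 2 - 1), sq_nonneg (b - 1)]

/-- The cubic and quartic integrals are controlled by the leading term and a power of the mass. -/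
theorem lower_order_terms_le {n A B C M T F : ℝ} (hn : 1 ≤ n) (hA : A ≤ n ^ 3)
    (hB : 0 ≤ B) (hC : 0 ≤ C) (hBC : B ^ 2 ≤ A * C) (hM : M ^ 4 ≤ 4 * (A * B))
    (hT : T ≤ M * B) (hF : F ≤ M ^ 2 * A) :
    5 / 3 * T ≤ C / 4 + 100000 * n ^ 7 ∧ 5 / 36 * F ≤ C / 4 + 100000 * n ^ 7 := by
  have hn0 : 0 < n := by linarith
  have hb : 0 ≤ B / n ^ 5 := by positivity
  have hmb : (M / n ^ 2) ^ 4 ≤ 4 * (B / n ^ 5) := by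
    have : M ^ 4 ≤ 4 * (n ^ 3 * B) := hM.trans (by gcongr)
    rw [div_pow, div_le_iff₀ (by positivity)]
    calc M ^ 4 ≤ _ := this
      _ = _ := by field_simp
  have hbc : (B / n ^ 5) ^ 2 ≤ C / n ^ 7 := by
    have : B ^ 2 ≤ n ^ 3 * C := hBC.trans (by gcongr)
    rw [div_pow, div_le_iff₀ (by positivity)]
    calc B ^ 2 ≤ _ := this
      _ = _ := by field_simp
  have h7 : 0 ≤ n ^ 7 := by positivity
  constructor
  · have h := mul_le_mul_of_nonneg_right (mul_le_of_pow_four_le hb hmb hbc) h7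
    have e1 : 5 / 3 * (M / n ^ 2 * (B / n ^ 5)) * n ^ 7 = 5 / 3 * (M * B) := by field_simp
    have e2 : (C / n ^ 7 / 4 + 100000) * n ^ 7 = C / 4 + 100000 * n ^ 7 := by field_simp
    linarith
  · have h := mul_le_mul_of_nonneg_right (sq_le_of_pow_four_le hmb hbc) h7
    have e1 : 5 / 36 * (M / n ^ 2) ^ 2 * n ^ 7 = 5 / 36 * (M ^ 2 * n ^ 3) := by field_simp
    have e2 : (C / n ^ 7 / 4 + 100000) * n ^ 7 = C / 4 + 100000 * n ^ 7 := by field_simp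
    have : M ^ 2 * A ≤ M ^ 2 * n ^ 3 := by gcongr
    linarith

/-- equivalence of the positivized second integral of motion `𝓘₂⁺`
with `‖D²v‖² + ᾱ(‖v‖² + 1)^{7/3}`. -/
theorem modified_I2_equivalence :
    ∃ α₀ : ℝ, 1 ≤ α₀ ∧
      ∀ α : ℝ, α₀ ≤ α →
        ∀ v : ℝ → ℝ, SmoothMeanZeroPeriodic v →
          (1 / 2) * ((L2norm (iteratedDeriv 2 v)) ^ 2
              + α * ((L2norm v) ^ 2 + 1) ^ ((7:ℝ)/3))
            ≤ (∫ x in (0:ℝ)..(2 * Real.pi),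
                  ((iteratedDeriv 2 v x) ^ 2 - (5/3) * v x * (deriv v x) ^ 2
                    + (5/36) * (v x) ^ 4))
                + α * ((L2norm v) ^ 2 + 1) ^ ((7:ℝ)/3) ∧
          (∫ x in (0:ℝ)..(2 * Real.pi),
                  ((iteratedDeriv 2 v x) ^ 2 - (5/3) * v x * (deriv v x) ^ 2
                    + (5/36) * (v x) ^ 4))
                + α * ((L2norm v) ^ 2 + 1) ^ ((7:ℝ)/3)
            ≤ (3 / 2) * ((L2norm (iteratedDeriv 2 v)) ^ 2
                + α * ((L2norm v) ^ 2 + 1) ^ ((7:ℝ)/3)) := by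
  refine ⟨400000, by norm_num, fun α hα v ⟨hsm, hper, hmean⟩ => ?_⟩
  have hpi : (0:ℝ) < 2 * Real.pi := by positivity
  have hv2 : ContDiff ℝ 2 v := contDiff_infty.mp hsm 2
  have hv1 : ContDiff ℝ 1 v := hv2.of_le one_le_two
  have hd1 : ContDiff ℝ 1 (deriv v) := ContDiff.deriv' (by simpa [one_add_one_eq_two] using hv2)
  have hc := hv2.continuous
  have hc' := hd1.continuous
  have hc'' : Continuous (deriv (deriv v)) := hd1.continuous_deriv le_rfl
  have h0 : v (2 * Real.pi) = v 0 := by simpa using hper 0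
  have h1 : deriv v (2 * Real.pi) = deriv v 0 := by
    have := deriv_comp_add_const v (2 * Real.pi) 0
    rw [funext hper, zero_add] at this
    exact this.symm
  rw [L2norm_sq, L2norm_sq, iteratedDeriv_succ, iteratedDeriv_one]
  have hBC := sq_integral_deriv_sq_le hv2 hpi.le h0 h1
  have hJ := sq_intervalIntegral_mul_le hc.abs hc'.abs hpi.le
  simp only [sq_abs] at hJ
  have hsup : ∀ x ∈ Set.Icc 0 (2 * Real.pi), _ := fun x hx =>
    sq_le_two_mul_integral_abs_mul_abs_deriv hv1 hpi hmean hx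
  have hsplit : ∫ x in (0:ℝ)..(2 * Real.pi), (deriv (deriv v) x ^ 2
      - (5/3) * v x * (deriv v x) ^ 2 + (5/36) * (v x) ^ 4)
      = (∫ x in (0:ℝ)..(2 * Real.pi), deriv (deriv v) x ^ 2)
        - 5 / 3 * (∫ x in (0:ℝ)..(2 * Real.pi), v x * deriv v x ^ 2)
        + 5 / 36 * ∫ x in (0:ℝ)..(2 * Real.pi), v x ^ 4 := by
    simp only [mul_assoc]
    rw [intervalIntegral.integral_add
        (Continuous.intervalIntegrable (by fun_prop) _ _)
        (Continuous.intervalIntegrable (by fun_prop) _ _),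
      intervalIntegral.integral_sub
        (Continuous.intervalIntegrable (by fun_prop) _ _)
        (Continuous.intervalIntegrable (by fun_prop) _ _),
      intervalIntegral.integral_const_mul, intervalIntegral.integral_const_mul]
  rw [hsplit]
  have hJ0 : 0 ≤ 2 * ∫ t in (0:ℝ)..(2 * Real.pi), |v t| * |deriv v t| :=
    mul_nonneg two_pos.le (intervalIntegral.integral_nonneg hpi.le fun t _ => by positivity)
  obtain ⟨M, hM0, hM⟩ : ∃ M : ℝ, 0 ≤ M ∧
      M ^ 2 = 2 * ∫ t in (0:ℝ)..(2 * Real.pi), |v t| * |deriv v t| :=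
    ⟨_, Real.sqrt_nonneg _, Real.sq_sqrt hJ0⟩
  rw [← hM] at hsup
  have hT : |∫ x in (0:ℝ)..(2 * Real.pi), v x * deriv v x ^ 2|
      ≤ M * ∫ x in (0:ℝ)..(2 * Real.pi), deriv v x ^ 2 := by
    rw [← intervalIntegral.integral_const_mul]
    refine (intervalIntegral.abs_integral_le_integral_abs hpi.le).trans
      (intervalIntegral.integral_mono_on hpi.le
        (Continuous.intervalIntegrable (by fun_prop) _ _)
        (Continuous.intervalIntegrable (by fun_prop) _ _) fun x hx => ?_)
    rw [abs_mul, abs_sq]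
    exact mul_le_mul_of_nonneg_right (abs_le_of_sq_le_sq (hsup x hx) hM0) (sq_nonneg _)
  have hF : ∫ x in (0:ℝ)..(2 * Real.pi), v x ^ 4
      ≤ M ^ 2 * ∫ x in (0:ℝ)..(2 * Real.pi), v x ^ 2 := by
    rw [← intervalIntegral.integral_const_mul]
    refine intervalIntegral.integral_mono_on hpi.le
        (Continuous.intervalIntegrable (by fun_prop) _ _)
        (Continuous.intervalIntegrable (by fun_prop) _ _) fun x hx => ?_
    nlinarith [hsup x hx, sq_nonneg (v x)]
  have hF0 : 0 ≤ ∫ x in (0:ℝ)..(2 * Real.pi), v x ^ 4 :=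
    intervalIntegral.integral_nonneg hpi.le fun x _ => by positivity
  have hA : 0 ≤ ∫ x in (0:ℝ)..(2 * Real.pi), v x ^ 2 :=
    intervalIntegral.integral_nonneg hpi.le fun x _ => by positivity
  have hB : 0 ≤ ∫ x in (0:ℝ)..(2 * Real.pi), deriv v x ^ 2 :=
    intervalIntegral.integral_nonneg hpi.le fun x _ => by positivity
  have hC : 0 ≤ ∫ x in (0:ℝ)..(2 * Real.pi), deriv (deriv v) x ^ 2 :=
    intervalIntegral.integral_nonneg hpi.le fun x _ => by positivity
  have hM4 : M ^ 4 ≤ 4 * ((∫ x in (0:ℝ)..(2 * Real.pi), v x ^ 2)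
      * ∫ x in (0:ℝ)..(2 * Real.pi), deriv v x ^ 2) := by
    have : M ^ 4 = (M ^ 2) ^ 2 := by ring
    rw [this, hM, mul_pow]
    linarith
  generalize (∫ x in (0:ℝ)..(2 * Real.pi), v x ^ 2) = A at *
  generalize (∫ x in (0:ℝ)..(2 * Real.pi), deriv v x ^ 2) = B at *
  generalize (∫ x in (0:ℝ)..(2 * Real.pi), deriv (deriv v) x ^ 2) = C at *
  generalize (∫ x in (0:ℝ)..(2 * Real.pi), v x * deriv v x ^ 2) = T at *
  generalize (∫ x in (0:ℝ)..(2 * Real.pi), v x ^ 4) = F at *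
  have hn : 1 ≤ (A + 1) ^ ((1:ℝ)/3) := Real.one_le_rpow (by linarith) (by norm_num)
  have hn3 : ((A + 1) ^ ((1:ℝ)/3)) ^ 3 = A + 1 := by
    rw [← Real.rpow_natCast, ← Real.rpow_mul (by linarith)]
    norm_num
  have hn7 : (A + 1) ^ ((7:ℝ)/3) = ((A + 1) ^ ((1:ℝ)/3)) ^ 7 := by
    rw [← Real.rpow_natCast, ← Real.rpow_mul (by linarith)]
    norm_num
  rw [hn7]
  generalize (A + 1) ^ ((1:ℝ)/3) = n at *
  obtain ⟨h3, h4⟩ := lower_order_terms_le hn (by linarith) hB hC hBC hM4 hT hF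
  have hP : 400000 * n ^ 7 ≤ α * n ^ 7 := by gcongr
  have := le_abs_self T
  have := neg_abs_le T
  constructor <;> linarith
end
end

section
/- Let u : ℝ × ℝ → ℝ be jointly smooth, 2π-periodic and mean-zero in x for each t, and satisfy the Korteweg–de Vries equation ∂_t u + u ∂_x u + ∂_x³ u = 0 pointwise. Then the Hamiltonian 𝓘₁(u(t)) := ∫₀^{2π} ( (∂_x u(t,x))² − u(t,x)³/3 ) dx is constant in t: 𝓘₁(u(t)) = 𝓘₁(u(0)) for all t ∈ ℝ. -/
open MeasureTheory Real Filter

noncomputable section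

/-- Integral form of a conservation law `∂ₜ e = ∂ₓ f`: if the flux `f` takes the same values at both
endpoints, the integral of the density `e` does not depend on time. -/
theorem integral_eq_of_conservation_law {e f e' : ℝ → ℝ → ℝ} {a b : ℝ}
    (he' : Continuous (Function.uncurry e'))
    (hecont : ∀ t, Continuous (e t))
    (he : ∀ t x, HasDerivAt (fun s => e s x) (e' t x) t)
    (hf : ∀ t x, HasDerivAt (f t) (e' t x) x)
    (hab : ∀ t, f t a = f t b) (t₀ t₁ : ℝ) :
    ∫ x in a..b, e t₁ x = ∫ x in a..b, e t₀ x := by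
  have hx : ∀ t, ∫ x in a..b, e' t x = 0 := fun t => by
    rw [intervalIntegral.integral_eq_sub_of_hasDerivAt (fun x _ => hf t x)
      ((by fun_prop : Continuous (e' t)).intervalIntegrable a b), hab, sub_self]
  have ht : ∀ x, ∫ t in t₀..t₁, e' t x = e t₁ x - e t₀ x := fun x =>
    intervalIntegral.integral_eq_sub_of_hasDerivAt (fun t _ => he t x)
      ((by fun_prop : Continuous fun t => e' t x).intervalIntegrable _ _)
  have hint : IntegrableOn (Function.uncurry fun x t => e' t x)
      (Set.uIoc a b ×ˢ Set.uIoc t₀ t₁) :=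
    ((by fun_prop : Continuous (Function.uncurry fun x t => e' t x)).continuousOn
      |>.integrableOn_compact (isCompact_uIcc.prod isCompact_uIcc)).mono_set
      (Set.prod_mono Set.uIoc_subset_uIcc Set.uIoc_subset_uIcc)
  have hswap := intervalIntegral_intervalIntegral_swap (F := fun x t => e' t x) (a := a) (b := b)
    (c := t₀) (d := t₁) hint
  simp only [hx, ht, intervalIntegral.integral_zero] at hswap
  rw [intervalIntegral.integral_sub ((hecont _).intervalIntegrable _ _)
    ((hecont _).intervalIntegrable _ _)] at hswap
  linarith

/-- Directional derivatives of a smooth function are smooth. -/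
theorem ContDiff.smooth_fderiv_apply_const {g : ℝ × ℝ → ℝ} (hg : ContDiff ℝ (⊤ : ℕ∞) g)
    (v : ℝ × ℝ) : ContDiff ℝ (⊤ : ℕ∞) (fun p => fderiv ℝ g p v) :=
  (hg.fderiv_right (m := (⊤ : ℕ∞)) (by simp)).clm_apply contDiff_const

theorem hasDerivAt_fst_slice {g : ℝ × ℝ → ℝ} (hg : Differentiable ℝ g) (t x : ℝ) :
    HasDerivAt (fun s => g (s, x)) (fderiv ℝ g (t, x) (1, 0)) t :=
  (hg (t, x)).hasFDerivAt.comp_hasDerivAt t ((hasDerivAt_id t).prodMk (hasDerivAt_const t x))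

theorem hasDerivAt_snd_slice {g : ℝ × ℝ → ℝ} (hg : Differentiable ℝ g) (t x : ℝ) :
    HasDerivAt (fun y => g (t, y)) (fderiv ℝ g (t, x) (0, 1)) x :=
  (hg (t, x)).hasFDerivAt.comp_hasDerivAt x ((hasDerivAt_const x t).prodMk (hasDerivAt_id x))

theorem fderiv_fderiv_apply_comm {g : ℝ × ℝ → ℝ} (hg : ContDiff ℝ (⊤ : ℕ∞) g) (v w p : ℝ × ℝ) :
    fderiv ℝ (fun q => fderiv ℝ g q v) p w = fderiv ℝ (fun q => fderiv ℝ g q w) p v := by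
  have hd : DifferentiableAt ℝ (fderiv ℝ g) p :=
    (hg.fderiv_right (m := 1) (by norm_cast)).differentiable (by simp) p
  have hsymm : IsSymmSndFDerivAt ℝ g p :=
    hg.contDiffAt.isSymmSndFDerivAt (by simpa using WithTop.coe_le_coe.2 (le_top : (2 : ℕ∞) ≤ ⊤))
  rw [fderiv_clm_apply hd (by fun_prop), fderiv_clm_apply hd (by fun_prop)]
  simpa using hsymm w v

theorem Function.Periodic.deriv {v : ℝ → ℝ} {c : ℝ} (hv : Function.Periodic v c) :
    Function.Periodic (deriv v) c := fun x => by
  rw [← deriv_comp_add_const, hv.funext]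

/-- conservation of the KdV Hamiltonian
`𝓘₁(v) = ∫ ((Dv)² − v³/3)` along smooth periodic solutions of KdV. -/
theorem kdv_hamiltonian_conserved (u : ℝ → ℝ → ℝ)
    (hsmooth : ContDiff ℝ (⊤ : ℕ∞) (fun p : ℝ × ℝ => u p.1 p.2))
    (hper : ∀ t : ℝ, SmoothMeanZeroPeriodic (u t))
    (hkdv : ∀ t x : ℝ,
      deriv (fun s => u s x) t + u t x * deriv (u t) x + iteratedDeriv 3 (u t) x = 0) :
    ∀ t : ℝ,
      (∫ x in (0:ℝ)..(2 * Real.pi), ((deriv (u t) x) ^ 2 - (u t x) ^ 3 / 3))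
        = ∫ x in (0:ℝ)..(2 * Real.pi), ((deriv (u 0) x) ^ 2 - (u 0 x) ^ 3 / 3) := by
  intro t₁
  set g : ℝ × ℝ → ℝ := fun p => u p.1 p.2
  set gt : ℝ × ℝ → ℝ := fun p => fderiv ℝ g p (1, 0)
  set gx : ℝ × ℝ → ℝ := fun p => fderiv ℝ g p (0, 1)
  set gxx : ℝ × ℝ → ℝ := fun p => fderiv ℝ gx p (0, 1)
  set gxxx : ℝ × ℝ → ℝ := fun p => fderiv ℝ gxx p (0, 1)
  set gxt : ℝ × ℝ → ℝ := fun p => fderiv ℝ gx p (1, 0)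
  have sgt : ContDiff ℝ (⊤ : ℕ∞) gt := hsmooth.smooth_fderiv_apply_const _
  have sgx : ContDiff ℝ (⊤ : ℕ∞) gx := hsmooth.smooth_fderiv_apply_const _
  have sgxx : ContDiff ℝ (⊤ : ℕ∞) gxx := sgx.smooth_fderiv_apply_const _
  have sgxt : ContDiff ℝ (⊤ : ℕ∞) gxt := sgx.smooth_fderiv_apply_const _
  have hu_t t x : HasDerivAt (fun s => u s x) (gt (t, x)) t :=
    hasDerivAt_fst_slice (hsmooth.differentiable (by simp)) t x
  have hu_x t x : HasDerivAt (u t) (gx (t, x)) x :=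
    hasDerivAt_snd_slice (hsmooth.differentiable (by simp)) t x
  have hux_t t x : HasDerivAt (fun s => gx (s, x)) (gxt (t, x)) t :=
    hasDerivAt_fst_slice (sgx.differentiable (by simp)) t x
  have hux_x t x : HasDerivAt (fun y => gx (t, y)) (gxx (t, x)) x :=
    hasDerivAt_snd_slice (sgx.differentiable (by simp)) t x
  have huxx_x t x : HasDerivAt (fun y => gxx (t, y)) (gxxx (t, x)) x :=
    hasDerivAt_snd_slice (sgxx.differentiable (by simp)) t x
  have hut_x t x : HasDerivAt (fun y => gt (t, y)) (gxt (t, x)) x := by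
    rw [show gxt (t, x) = fderiv ℝ gt (t, x) (0, 1) from fderiv_fderiv_apply_comm hsmooth _ _ _]
    exact hasDerivAt_snd_slice (sgt.differentiable (by simp)) t x
  have du t : deriv (u t) = fun x => gx (t, x) := funext fun x => (hu_x t x).deriv
  have dux t : deriv (fun x => gx (t, x)) = fun x => gxx (t, x) := funext fun x => (hux_x t x).deriv
  have duxx t : deriv (fun x => gxx (t, x)) = fun x => gxxx (t, x) :=
    funext fun x => (huxx_x t x).deriv
  have kdv t x : gt (t, x) + u t x * gx (t, x) + gxxx (t, x) = 0 := by
    simpa only [(hu_t t x).deriv, du, dux, duxx, iteratedDeriv_succ, iteratedDeriv_zero]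
      using hkdv t x
  have per t : Function.Periodic (u t) (2 * π) := (hper t).2.1
  have per_x t : Function.Periodic (fun x => gx (t, x)) (2 * π) := du t ▸ (per t).deriv
  have per_xx t : Function.Periodic (fun x => gxx (t, x)) (2 * π) := dux t ▸ (per_x t).deriv
  have per_t t : Function.Periodic (fun x => gt (t, x)) (2 * π) := fun x => by
    simp only [← (hu_t t _).deriv, per _ x]
  have cu : Continuous g := hsmooth.continuous
  have cgt := sgt.continuous
  have cgx := sgx.continuous
  have cgxt := sgxt.continuous
  simp only [du]
  refine integral_eq_of_conservation_law
    (e := fun t x => gx (t, x) ^ 2 - u t x ^ 3 / 3)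
    (e' := fun t x => 2 * gx (t, x) * gxt (t, x) - u t x ^ 2 * gt (t, x))
    (f := fun t x => 2 * gx (t, x) * gt (t, x) + (gxx (t, x) + u t x ^ 2 / 2) ^ 2)
    ?_ (fun t => ?_) (fun t x => ?_) (fun t x => ?_) (fun t => ?_) 0 t₁
  · change Continuous fun p : ℝ × ℝ => 2 * gx p * gxt p - g p ^ 2 * gt p
    fun_prop
  · change Continuous fun x => gx (t, x) ^ 2 - g (t, x) ^ 3 / 3
    fun_prop
  · refine (((hux_t t x).pow 2).sub (((hu_t t x).pow 3).div_const 3)).congr_deriv ?_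
    push_cast
    ring
  · refine ((((hux_x t x).const_mul 2).mul (hut_x t x)).add
      (((huxx_x t x).add (((hu_x t x).pow 2).div_const 2)).pow 2)).congr_deriv ?_
    simp only [Pi.add_apply, Pi.pow_apply]
    push_cast
    linear_combination 2 * (gxx (t, x) + u t x ^ 2 / 2) * kdv t x
  · have h0 := per t 0
    have h1 := per_x t 0
    have h2 := per_xx t 0
    have h3 := per_t t 0
    simp only [zero_add] at h0 h1 h2 h3
    simp only [h0, h1, h2, h3]
end
end

section
/- Let u : ℝ × ℝ → ℝ be jointly smooth, 2π-periodic and mean-zero in x for each t, and satisfy the Korteweg–de Vries equation ∂_t u + u ∂_x u + ∂_x³ u = 0 pointwise. Then the second integral of motion 𝓘₂(u(t)) := ∫₀^{2π} ( (∂_x² u(t,x))² − (5/3) u(t,x) (∂_x u(t,x))² + (5/36) u(t,x)⁴ ) dx is constant in t: 𝓘₂(u(t)) = 𝓘₂(u(0)) for all t ∈ ℝ. -/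
open MeasureTheory Real Filter

noncomputable section

/-- The derivative of `f : ℝ × ℝ → ℝ` in the direction `v`, as a function on the plane. -/
def directionalDeriv (v : ℝ × ℝ) (f : ℝ × ℝ → ℝ) : ℝ × ℝ → ℝ :=
  fun p => fderiv ℝ f p v

lemma ContDiff.directionalDeriv {f : ℝ × ℝ → ℝ} (hf : ContDiff ℝ (⊤ : ℕ∞) f) (v : ℝ × ℝ) :
    ContDiff ℝ (⊤ : ℕ∞) (directionalDeriv v f) :=
  (hf.fderiv_right (m := (⊤ : ℕ∞)) (by norm_cast)).clm_apply contDiff_const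

lemma directionalDeriv_comm {f : ℝ × ℝ → ℝ} (hf : ContDiff ℝ (⊤ : ℕ∞) f) (v w : ℝ × ℝ) :
    directionalDeriv v (directionalDeriv w f) = directionalDeriv w (directionalDeriv v f) := by
  have hd : Differentiable ℝ (fderiv ℝ f) :=
    (hf.fderiv_right (m := (⊤ : ℕ∞)) (by norm_cast)).differentiable (by simp)
  have key : ∀ (a b p : ℝ × ℝ),
      directionalDeriv a (directionalDeriv b f) p = fderiv ℝ (fderiv ℝ f) p a b := by
    intro a b p
    have h := ((hd p).hasFDerivAt.clm_apply (hasFDerivAt_const b p)).fderiv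
    change fderiv ℝ (fun y => fderiv ℝ f y b) p a = _
    simp [h]
  ext p
  rw [key, key]
  exact second_derivative_symmetric (fun y => (hf.differentiable (by simp) y).hasFDerivAt)
    (hd p).hasFDerivAt v w

lemma hasDerivAt_directionalDeriv_fst {f : ℝ × ℝ → ℝ} (hf : ContDiff ℝ (⊤ : ℕ∞) f) (t x : ℝ) :
    HasDerivAt (fun s => f (s, x)) (directionalDeriv (1, 0) f (t, x)) t :=
  ((hf.differentiable (by simp) (t, x)).hasFDerivAt).comp_hasDerivAt t
    ((hasDerivAt_id t).prodMk (hasDerivAt_const t x))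

lemma hasDerivAt_directionalDeriv_snd {f : ℝ × ℝ → ℝ} (hf : ContDiff ℝ (⊤ : ℕ∞) f) (t x : ℝ) :
    HasDerivAt (fun y => f (t, y)) (directionalDeriv (0, 1) f (t, x)) x :=
  ((hf.differentiable (by simp) (t, x)).hasFDerivAt).comp_hasDerivAt x
    ((hasDerivAt_const x t).prodMk (hasDerivAt_id x))

lemma iteratedDeriv_slice {f : ℝ × ℝ → ℝ} (hf : ContDiff ℝ (⊤ : ℕ∞) f) (n : ℕ) (t : ℝ) :
    iteratedDeriv n (fun y => f (t, y)) =
      fun x => (directionalDeriv (0, 1))^[n] f (t, x) := by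
  induction n generalizing f with
  | zero => simp
  | succ n ih =>
    rw [iteratedDeriv_succ', Function.iterate_succ_apply, ← ih (hf.directionalDeriv _)]
    congr 1
    ext x
    exact (hasDerivAt_directionalDeriv_snd hf t x).deriv

lemma directionalDeriv_periodic {f : ℝ × ℝ → ℝ} {c : ℝ} (hf : ContDiff ℝ (⊤ : ℕ∞) f)
    (hper : ∀ t x, f (t, x + c) = f (t, x)) (t x : ℝ) :
    directionalDeriv (0, 1) f (t, x + c) = directionalDeriv (0, 1) f (t, x) := by
  rw [← (hasDerivAt_directionalDeriv_snd hf t (x + c)).deriv,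
    ← (hasDerivAt_directionalDeriv_snd hf t x).deriv, ← deriv_comp_add_const]
  simp only [hper]

/-- A density whose time derivative is the space derivative of a periodic flux has a
conserved integral over the period. -/
lemma integral_eq_of_conservation_law_s6 {F G : ℝ × ℝ → ℝ} {c : ℝ}
    (hF : ContDiff ℝ (⊤ : ℕ∞) F) (hG : ContDiff ℝ (⊤ : ℕ∞) G)
    (hper : ∀ t, G (t, c) = G (t, 0))
    (hlaw : ∀ p, directionalDeriv (1, 0) F p = directionalDeriv (0, 1) G p) (s t : ℝ) :
    ∫ x in (0 : ℝ)..c, F (t, x) = ∫ x in (0 : ℝ)..c, F (s, x) := by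
  have hdiv : ∀ p, fderiv ℝ F p (1, 0) + (-fderiv ℝ G p) (0, 1) = 0 := fun p => by
    simpa [directionalDeriv, sub_eq_add_neg] using sub_eq_zero.mpr (hlaw p)
  have h := integral2_divergence_prod_of_hasFDerivAt F (fun p => -G p)
    (fun p => fderiv ℝ F p) (fun p => -fderiv ℝ G p) s 0 t c
    hF.continuous.continuousOn hG.continuous.neg.continuousOn
    (fun p _ => (hF.differentiable (by simp) p).hasFDerivAt)
    (fun p _ => (hG.differentiable (by simp) p).hasFDerivAt.neg)
    (by simp only [hdiv]; exact integrableOn_zero)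
  simp only [hdiv, hper, intervalIntegral.integral_zero] at h
  linarith

/-- conservation of the second KdV integral of motion
`𝓘₂(v) = ∫ ((D²v)² − (5/3) v (Dv)² + (5/36) v⁴)` along smooth periodic solutions of KdV. -/
theorem kdv_I2_conserved (u : ℝ → ℝ → ℝ)
    (hsmooth : ContDiff ℝ (⊤ : ℕ∞) (fun p : ℝ × ℝ => u p.1 p.2))
    (hper : ∀ t : ℝ, SmoothMeanZeroPeriodic (u t))
    (hkdv : ∀ t x : ℝ,
      deriv (fun s => u s x) t + u t x * deriv (u t) x + iteratedDeriv 3 (u t) x = 0) :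
    ∀ t : ℝ,
      (∫ x in (0:ℝ)..(2 * Real.pi),
          ((iteratedDeriv 2 (u t) x) ^ 2 - (5/3) * u t x * (deriv (u t) x) ^ 2
            + (5/36) * (u t x) ^ 4))
        = ∫ x in (0:ℝ)..(2 * Real.pi),
          ((iteratedDeriv 2 (u 0) x) ^ 2 - (5/3) * u 0 x * (deriv (u 0) x) ^ 2
            + (5/36) * (u 0 x) ^ 4) := by
  intro t
  set f : ℝ × ℝ → ℝ := fun p => u p.1 p.2
  set f₁ := directionalDeriv (0, 1) f with hf₁
  set f₂ := directionalDeriv (0, 1) f₁ with hf₂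
  set f₃ := directionalDeriv (0, 1) f₂ with hf₃
  set f₄ := directionalDeriv (0, 1) f₃ with hf₄
  have s₁ : ContDiff ℝ (⊤ : ℕ∞) f₁ := hsmooth.directionalDeriv _
  have s₂ : ContDiff ℝ (⊤ : ℕ∞) f₂ := s₁.directionalDeriv _
  have s₃ : ContDiff ℝ (⊤ : ℕ∞) f₃ := s₂.directionalDeriv _
  have s₄ : ContDiff ℝ (⊤ : ℕ∞) f₄ := s₃.directionalDeriv _
  have p₀ : ∀ t x, f (t, x + 2 * π) = f (t, x) := fun t => (hper t).2.1
  have p₁ : ∀ t x, f₁ (t, x + 2 * π) = f₁ (t, x) := directionalDeriv_periodic hsmooth p₀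
  have p₂ : ∀ t x, f₂ (t, x + 2 * π) = f₂ (t, x) := directionalDeriv_periodic s₁ p₁
  have p₃ : ∀ t x, f₃ (t, x + 2 * π) = f₃ (t, x) := directionalDeriv_periodic s₂ p₂
  have p₄ : ∀ t x, f₄ (t, x + 2 * π) = f₄ (t, x) := directionalDeriv_periodic s₃ p₃
  have d₁ : ∀ t x, deriv (u t) x = f₁ (t, x) := fun t x =>
    (hasDerivAt_directionalDeriv_snd hsmooth t x).deriv
  have d₂ : ∀ t x, iteratedDeriv 2 (u t) x = f₂ (t, x) := fun t x =>
    congrFun (iteratedDeriv_slice hsmooth 2 t) x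
  have d₃ : ∀ t x, iteratedDeriv 3 (u t) x = f₃ (t, x) := fun t x =>
    congrFun (iteratedDeriv_slice hsmooth 3 t) x
  have X₀ := hasDerivAt_directionalDeriv_snd hsmooth
  have X₁ := hasDerivAt_directionalDeriv_snd s₁
  have X₂ := hasDerivAt_directionalDeriv_snd s₂
  have X₃ := hasDerivAt_directionalDeriv_snd s₃
  have X₄ := hasDerivAt_directionalDeriv_snd s₄
  have e₀ : directionalDeriv (1, 0) f = fun p => -(f p * f₁ p + f₃ p) := by
    ext ⟨t, x⟩
    have h := hkdv t x
    rw [d₁, d₃, (hasDerivAt_directionalDeriv_fst hsmooth t x).deriv] at h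
    linear_combination h
  have r₀ : ContDiff ℝ (⊤ : ℕ∞) (fun p => -(f p * f₁ p + f₃ p)) :=
    ((hsmooth.mul s₁).add s₃).neg
  have e₁ : directionalDeriv (1, 0) f₁ = fun p => -(f₁ p * f₁ p + f p * f₂ p + f₄ p) := by
    rw [hf₁, directionalDeriv_comm hsmooth, e₀]
    ext ⟨t, x⟩
    exact (hasDerivAt_directionalDeriv_snd r₀ t x).unique
      (((X₀ t x).mul (X₁ t x)).add (X₃ t x)).neg
  have r₁ : ContDiff ℝ (⊤ : ℕ∞) (fun p => -(f₁ p * f₁ p + f p * f₂ p + f₄ p)) :=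
    (((s₁.mul s₁).add (hsmooth.mul s₂)).add s₄).neg
  have e₂ : directionalDeriv (1, 0) f₂ =
      fun p => -(3 * f₁ p * f₂ p + f p * f₃ p + directionalDeriv (0, 1) f₄ p) := by
    rw [hf₂, directionalDeriv_comm s₁, e₁]
    ext ⟨t, x⟩
    refine (hasDerivAt_directionalDeriv_snd r₁ t x).unique
      (((((X₁ t x).mul (X₁ t x)).add ((X₀ t x).mul (X₂ t x))).add (X₄ t x)).neg.congr_deriv ?_)
    ring
  have hF : ContDiff ℝ (⊤ : ℕ∞)
      (fun p => f₂ p ^ 2 - (5/3) * f p * f₁ p ^ 2 + (5/36) * f p ^ 4) := by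
    fun_prop
  have hG : ContDiff ℝ (⊤ : ℕ∞)
      (fun p => -2 * (f₂ p * f₄ p) + f₃ p ^ 2 + (10/3) * (f p * f₁ p * f₃ p)
        - (8/3) * (f p * f₂ p ^ 2) - (5/3) * (f₁ p ^ 2 * f₂ p) - (5/9) * (f p ^ 3 * f₂ p)
        + (5/2) * (f p ^ 2 * f₁ p ^ 2) - (1/9) * f p ^ 5) := by
    fun_prop
  have main := integral_eq_of_conservation_law_s6 (c := 2 * π) hF hG (fun t => ?_) ?_ 0 t
  · simpa only [d₁, d₂] using main
  · have q (g : ℝ × ℝ → ℝ) (hg : ∀ t x, g (t, x + 2 * π) = g (t, x)) :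
        g (t, 2 * π) = g (t, 0) := by simpa using hg t 0
    simp only [q f p₀, q f₁ p₁, q f₂ p₂, q f₃ p₃, q f₄ p₄]
  · rintro ⟨t, x⟩
    have T₀ := hasDerivAt_directionalDeriv_fst hsmooth t x
    have T₁ := hasDerivAt_directionalDeriv_fst s₁ t x
    have T₂ := hasDerivAt_directionalDeriv_fst s₂ t x
    rw [e₀] at T₀
    rw [e₁] at T₁
    rw [e₂] at T₂
    replace X₀ := X₀ t x
    replace X₁ := X₁ t x
    replace X₂ := X₂ t x
    replace X₃ := X₃ t x
    replace X₄ := X₄ t x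
    rw [(hasDerivAt_directionalDeriv_fst hF t x).unique
        (((T₂.pow 2).sub ((T₀.const_mul (5/3)).mul (T₁.pow 2))).add ((T₀.pow 4).const_mul (5/36))),
      (hasDerivAt_directionalDeriv_snd hG t x).unique
        ((((((((X₂.mul X₄).const_mul (-2)).add (X₃.pow 2)).add
          (((X₀.mul X₁).mul X₃).const_mul (10/3))).sub
          ((X₀.mul (X₂.pow 2)).const_mul (8/3))).sub
          (((X₁.pow 2).mul X₂).const_mul (5/3))).sub
          (((X₀.pow 3).mul X₂).const_mul (5/9))).add
          (((X₀.pow 2).mul (X₁.pow 2)).const_mul (5/2)) |>.sub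
          ((X₀.pow 5).const_mul (1/9)))]
    simp only [← hf₁, ← hf₂, ← hf₃, ← hf₄, Pi.pow_apply, Pi.mul_apply]
    push_cast
    ring
end
end
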